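/- For every Λ ∈ L^H_Γ and every nonzero δΛ ∈ Range Γ, the Hessian quadratic form is strictly positive: δ²J_Ψ(Λ; δΛ, δΛ) = 2 tr ∫ Ψ Q_Λ^{-1} G* δΛ G Q_Λ^{-1} G* δΛ G Q_Λ^{-1} > 0. -/

import Mathlib

open Matrix MeasureTheory
open scoped ComplexOrder

/-- Entrywise integral over the unit circle, `∫_{-π}^{π} F(e^{jθ}) dθ/2π`. -/
noncomputable def circleIntM {n m : ℕ} (F : ℝ → Matrix (Fin n) (Fin m) ℂ) :
    Matrix (Fin n) (Fin m) ℂ :=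
  Matrix.of fun i j => (2 * (Real.pi : ℂ))⁻¹ * ∫ θ in (-Real.pi)..Real.pi, F θ i j

/-- The transfer function `G(z) = (zI - A)⁻¹ B` evaluated at `z = e^{jθ}`. -/
noncomputable def Gfun {n m : ℕ} (A : Matrix (Fin n) (Fin n) ℂ)
    (B : Matrix (Fin n) (Fin m) ℂ) (θ : ℝ) : Matrix (Fin n) (Fin m) ℂ :=
  (Complex.exp (θ * Complex.I) • (1 : Matrix (Fin n) (Fin n) ℂ) - A)⁻¹ * B

/-- The pair `(A, B)` is reachable: the controllability matrix
`[B, AB, ..., A^{n-1}B]` has rank `n`. -/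
noncomputable def IsReachable {n m : ℕ} (A : Matrix (Fin n) (Fin n) ℂ)
    (B : Matrix (Fin n) (Fin m) ℂ) : Prop :=
  (Matrix.of fun (i : Fin n) (p : Fin n × Fin m) => (A ^ (p.1 : ℕ) * B) i p.2).rank = n

/-- `Q_Λ(e^{jθ}) = I + G(e^{jθ})* Λ G(e^{jθ})`. -/
noncomputable def Qfun {n m : ℕ} (A : Matrix (Fin n) (Fin n) ℂ)
    (B : Matrix (Fin n) (Fin m) ℂ) (Λ : Matrix (Fin n) (Fin n) ℂ) (θ : ℝ) :
    Matrix (Fin m) (Fin m) ℂ :=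
  (1 : Matrix (Fin m) (Fin m) ℂ) + (Gfun A B θ)ᴴ * Λ * Gfun A B θ

/-- The dual functional `J_Ψ(Λ) = tr ∫ Q_Λ⁻¹ Ψ + tr Λ` (a real number). -/
noncomputable def Jfun {n m : ℕ} (A : Matrix (Fin n) (Fin n) ℂ)
    (B : Matrix (Fin n) (Fin m) ℂ) (Ψ : ℝ → Matrix (Fin m) (Fin m) ℂ)
    (Λ : Matrix (Fin n) (Fin n) ℂ) : ℝ :=
  ((circleIntM fun θ => (Qfun A B Λ θ)⁻¹ * Ψ θ).trace + Λ.trace).re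

/-- `M` belongs to `Range Γ`: it is `∫ G Φ G*` for some continuous Hermitian-matrix-valued
function `Φ` on the unit circle. -/
def InRangeGamma {n m : ℕ} (A : Matrix (Fin n) (Fin n) ℂ) (B : Matrix (Fin n) (Fin m) ℂ)
    (M : Matrix (Fin n) (Fin n) ℂ) : Prop :=
  ∃ Φ : ℝ → Matrix (Fin m) (Fin m) ℂ,
    Continuous Φ ∧ Function.Periodic Φ (2 * Real.pi) ∧
    (∀ θ : ℝ, (Φ θ).IsHermitian) ∧
    circleIntM (fun θ => Gfun A B θ * Φ θ * (Gfun A B θ)ᴴ) = M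

/-- The Hessian quadratic form value `2 tr ∫ Ψ Q_Λ⁻¹ G* δΛ G Q_Λ⁻¹ G* δΛ G Q_Λ⁻¹`. -/
noncomputable def hessQuad {n m : ℕ} (A : Matrix (Fin n) (Fin n) ℂ)
    (B : Matrix (Fin n) (Fin m) ℂ) (Ψ : ℝ → Matrix (Fin m) (Fin m) ℂ)
    (Λ δΛ : Matrix (Fin n) (Fin n) ℂ) : ℂ :=
  2 * (circleIntM fun θ =>
        Ψ θ * (Qfun A B Λ θ)⁻¹ * (Gfun A B θ)ᴴ * δΛ * Gfun A B θ *
          (Qfun A B Λ θ)⁻¹ * (Gfun A B θ)ᴴ * δΛ * Gfun A B θ * (Qfun A B Λ θ)⁻¹).trace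

open Set Filter Topology

/-- Differentiation under an interval integral, when the integrand and its derivative are jointly
continuous. -/
theorem hasDerivAt_intervalIntegral_of_continuousOn {a b : ℝ} {F F' : ℝ → ℝ → ℂ} {V : Set ℝ}
    (hV : IsOpen V) (hab : a ≤ b)
    (hF : ContinuousOn (Function.uncurry F) (V ×ˢ Icc a b))
    (hF' : ContinuousOn (Function.uncurry F') (V ×ˢ Icc a b))
    (hd : ∀ x ∈ V, ∀ θ ∈ Icc a b, HasDerivAt (fun y => F y θ) (F' x θ) x) {x : ℝ} (hx : x ∈ V) :
    HasDerivAt (fun y => ∫ θ in a..b, F y θ) (∫ θ in a..b, F' x θ) x := by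
  obtain ⟨ε, hε, hεV⟩ := Metric.nhds_basis_closedBall.mem_iff.1 (hV.mem_nhds hx)
  have slice : ∀ {f : ℝ → ℝ → ℂ}, ContinuousOn (Function.uncurry f) (V ×ˢ Icc a b) →
      ∀ y ∈ V, ContinuousOn (f y) (Icc a b) := fun hf y hy =>
    hf.comp (f := fun θ => (y, θ)) (by fun_prop) fun θ hθ => ⟨hy, hθ⟩
  obtain ⟨C, hC⟩ := ((isCompact_closedBall x ε).prod (isCompact_Icc (a := a) (b := b))
    ).exists_bound_of_continuousOn (hF'.mono (prod_mono hεV Subset.rfl))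
  have hsub : Set.uIoc a b ⊆ Icc a b := by rw [uIoc_of_le hab]; exact Ioc_subset_Icc_self
  refine (intervalIntegral.hasDerivAt_integral_of_dominated_loc_of_deriv_le (F' := F')
    (bound := fun _ => C) (Metric.closedBall_mem_nhds x hε) ?_ ?_ ?_ ?_
    intervalIntegrable_const ?_).2
  · filter_upwards [hV.mem_nhds hx] with y hy
    exact ((slice hF y hy).mono hsub).aestronglyMeasurable measurableSet_uIoc
  · exact (slice hF x hx).intervalIntegrable_of_Icc hab
  · exact ((slice hF' x hx).mono hsub).aestronglyMeasurable measurableSet_uIoc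
  · exact .of_forall fun θ hθ y hy => hC (y, θ) ⟨hy, hsub hθ⟩
  · exact .of_forall fun θ hθ y hy => hd y (hεV hy) θ (hsub hθ)

section MatrixInverse

open scoped Matrix.Norms.Operator

variable {m : ℕ}

theorem Matrix.continuousAt_inv_of_isUnit {M : Matrix (Fin m) (Fin m) ℂ} (hM : IsUnit M) :
    ContinuousAt (fun N : Matrix (Fin m) (Fin m) ℂ => N⁻¹) M := by
  obtain ⟨u, rfl⟩ := hM
  simpa only [nonsing_inv_eq_ringInverse] using! NormedRing.inverse_continuousAt u

theorem Matrix.hasDerivAt_inv_add_smul {Q H : Matrix (Fin m) (Fin m) ℂ} {x : ℝ}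
    (hu : IsUnit (Q + x • H)) :
    HasDerivAt (fun y : ℝ => (Q + y • H)⁻¹) (-((Q + x • H)⁻¹ * H * (Q + x • H)⁻¹)) x := by
  have h1 : HasDerivAt (fun y : ℝ => Q + y • H) H x :=
    (((hasDerivAt_id x).smul_const H).const_add Q).congr_deriv (one_smul ℝ H)
  have hinv := nonsing_inv_eq_ringInverse (A := Q + x • H)
  obtain ⟨u, hu⟩ := hu
  rw [← hu, Ring.inverse_unit] at hinv
  have h2 := hasFDerivAt_ringInverse (𝕜 := ℝ) u
  rw [hu] at h2
  simpa only [nonsing_inv_eq_ringInverse, ← hinv, hu, _root_.neg_apply,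
    ContinuousLinearMap.mulLeftRight_apply] using! h2.comp_hasDerivAt x h1

theorem HasDerivAt.matrix_trace {f : ℝ → Matrix (Fin m) (Fin m) ℂ} {f' : Matrix (Fin m) (Fin m) ℂ}
    {x : ℝ} (h : HasDerivAt f f' x) : HasDerivAt (fun y => (f y).trace) f'.trace x :=
  (LinearMap.toContinuousLinearMap (traceLinearMap (Fin m) ℝ ℂ)).hasFDerivAt.comp_hasDerivAt x h

theorem Matrix.hasDerivAt_trace_inv_mul {Q H Ψ : Matrix (Fin m) (Fin m) ℂ} {x : ℝ}
    (hu : IsUnit (Q + x • H)) :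
    HasDerivAt (fun y : ℝ => ((Q + y • H)⁻¹ * Ψ).trace)
      (-((Q + x • H)⁻¹ * H * (Q + x • H)⁻¹ * Ψ).trace) x :=
  ((hasDerivAt_inv_add_smul hu).mul_const Ψ).matrix_trace.congr_deriv (by simp)

theorem Matrix.hasDerivAt_neg_trace_inv_mul_mul {Q H Ψ : Matrix (Fin m) (Fin m) ℂ} {x : ℝ}
    (hu : IsUnit (Q + x • H)) :
    HasDerivAt (fun y : ℝ => -((Q + y • H)⁻¹ * H * (Q + y • H)⁻¹ * Ψ).trace)
      (2 * ((Q + x • H)⁻¹ * H * (Q + x • H)⁻¹ * H * (Q + x • H)⁻¹ * Ψ).trace) x := by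
  have h1 := hasDerivAt_inv_add_smul hu
  refine (((h1.mul_const H).mul h1).mul_const Ψ).matrix_trace.neg.congr_deriv ?_
  simp [Matrix.mul_assoc, Matrix.add_mul, two_mul]

end MatrixInverse

section TraceIntegral

variable {n m : ℕ}

theorem trace_mul_circleIntM (N : Matrix (Fin m) (Fin n) ℂ) {F : ℝ → Matrix (Fin n) (Fin m) ℂ}
    (hF : ContinuousOn F (Icc (-Real.pi) Real.pi)) :
    (N * circleIntM F).trace =
      (2 * (Real.pi : ℂ))⁻¹ * ∫ θ in (-Real.pi)..Real.pi, (N * F θ).trace := by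
  have hπ : -Real.pi ≤ Real.pi := by linarith [Real.pi_pos]
  have hij : ∀ i j, IntervalIntegrable (fun θ => N i j * F θ j i) volume (-Real.pi) Real.pi :=
    fun i j => (ContinuousOn.mul continuousOn_const
      ((continuous_id.matrix_elem j i).comp_continuousOn hF)).intervalIntegrable_of_Icc hπ
  have hi : ∀ i, IntervalIntegrable (fun θ => ∑ j, N i j * F θ j i) volume
      (-Real.pi) Real.pi := fun i => by
    simpa [Finset.sum_fn] using! IntervalIntegrable.sum Finset.univ fun j _ => hij i j
  simp only [trace, diag_apply, mul_apply, circleIntM, of_apply]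
  rw [intervalIntegral.integral_finsetSum fun i _ => hi i,
    Finset.mul_sum]
  refine Finset.sum_congr rfl fun i _ => ?_
  rw [intervalIntegral.integral_finsetSum fun j _ => hij i j, Finset.mul_sum]
  refine Finset.sum_congr rfl fun j _ => ?_
  rw [intervalIntegral.integral_const_mul]
  ring

theorem trace_circleIntM {F : ℝ → Matrix (Fin m) (Fin m) ℂ}
    (hF : ContinuousOn F (Icc (-Real.pi) Real.pi)) :
    (circleIntM F).trace = (2 * (Real.pi : ℂ))⁻¹ * ∫ θ in (-Real.pi)..Real.pi, (F θ).trace := by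
  simpa using trace_mul_circleIntM 1 hF

theorem isHermitian_circleIntM {F : ℝ → Matrix (Fin n) (Fin n) ℂ}
    (hF : ∀ θ, (F θ).IsHermitian) : (circleIntM F).IsHermitian := by
  ext i j
  simp only [circleIntM, conjTranspose_apply, of_apply, intervalIntegral, RCLike.star_def, map_mul,
    map_sub, map_inv₀, Complex.conj_ofReal, map_ofNat, ← integral_conj]
  congr! with θ θ <;> simpa using (hF _).apply i j

end TraceIntegral

section Positivity

open scoped MatrixOrder

variable {m : ℕ}

theorem Matrix.PosDef.exists_isUnit_conjTranspose_mul_self {M : Matrix (Fin m) (Fin m) ℂ}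
    (hM : M.PosDef) : ∃ C : Matrix (Fin m) (Fin m) ℂ, IsUnit C ∧ M = Cᴴ * C :=
  CStarAlgebra.isStrictlyPositive_iff_eq_star_mul_self.mp hM.isStrictlyPositive

theorem trace_mul_conjTranspose_mul_mul {Ψ P X : Matrix (Fin m) (Fin m) ℂ}
    (hΨ : Ψ.PosDef) (hP : P.PosDef) :
    0 ≤ (Ψ * (Xᴴ * P * X)).trace ∧ ((Ψ * (Xᴴ * P * X)).trace = 0 → X = 0) := by
  obtain ⟨C, hC, rfl⟩ := hΨ.exists_isUnit_conjTranspose_mul_self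
  obtain ⟨D, hD, rfl⟩ := hP.exists_isUnit_conjTranspose_mul_self
  have key : (Cᴴ * C * (Xᴴ * (Dᴴ * D) * X)).trace = ((D * X * Cᴴ)ᴴ * (D * X * Cᴴ)).trace := by
    rw [Matrix.mul_assoc, trace_mul_comm]
    simp [Matrix.mul_assoc]
  rw [key]
  refine ⟨(posSemidef_conjTranspose_mul_self _).trace_nonneg, fun h => ?_⟩
  rw [trace_conjTranspose_mul_self_eq_zero_iff] at h
  have hC' : IsUnit Cᴴ := hC.star
  exact (hD.mul_right_eq_zero).1 ((hC'.mul_left_eq_zero).1 h)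

end Positivity

section TransferFunction

variable {n m : ℕ} {A : Matrix (Fin n) (Fin n) ℂ}

theorem continuous_Gfun (hA : ∀ z ∈ spectrum ℂ A, ‖z‖ < 1) (B : Matrix (Fin n) (Fin m) ℂ) :
    Continuous (Gfun A B) := by
  refine Continuous.matrix_mul ?_ continuous_const
  rw [continuous_iff_continuousAt]
  intro θ
  have hu : IsUnit (Complex.exp (θ * Complex.I) • (1 : Matrix (Fin n) (Fin n) ℂ) - A) := by
    by_contra h
    have := hA (Complex.exp (θ * Complex.I)) (by
      rwa [spectrum.mem_iff, Algebra.algebraMap_eq_smul_one])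
    simp [Complex.norm_exp_ofReal_mul_I] at this
  exact (continuousAt_inv_of_isUnit hu).comp
    (f := fun θ : ℝ => Complex.exp (θ * Complex.I) • (1 : Matrix (Fin n) (Fin n) ℂ) - A)
    (by fun_prop)

theorem Qfun_add_smul (B : Matrix (Fin n) (Fin m) ℂ) (Λ δΛ : Matrix (Fin n) (Fin n) ℂ) (x θ : ℝ) :
    Qfun A B (Λ + x • δΛ) θ = Qfun A B Λ θ + x • ((Gfun A B θ)ᴴ * δΛ * Gfun A B θ) := by
  simp [Qfun, Matrix.mul_add, Matrix.add_mul, add_assoc]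

theorem eq_zero_of_inRangeGamma {B : Matrix (Fin n) (Fin m) ℂ}
    (hG : Continuous (Gfun A B)) {M : Matrix (Fin n) (Fin n) ℂ} (hM : InRangeGamma A B M)
    (h : ∀ θ ∈ Icc (-Real.pi) Real.pi, (Gfun A B θ)ᴴ * Mᴴ * Gfun A B θ = 0) : M = 0 := by
  obtain ⟨Φ, hΦ, -, -, hΦM⟩ := hM
  have hπ : -Real.pi ≤ Real.pi := by linarith [Real.pi_pos]
  have hc : Continuous fun θ => Gfun A B θ * Φ θ * (Gfun A B θ)ᴴ :=
    (hG.matrix_mul hΦ).matrix_mul hG.matrix_conjTranspose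
  have htr := trace_mul_circleIntM Mᴴ hc.continuousOn
  rw [hΦM, intervalIntegral.integral_congr (g := fun _ => (0 : ℂ))] at htr
  · exact trace_conjTranspose_mul_self_eq_zero_iff.1 (by simpa using htr)
  · intro θ hθ
    rw [uIcc_of_le hπ] at hθ
    have : (Mᴴ * (Gfun A B θ * Φ θ * (Gfun A B θ)ᴴ)).trace =
        ((Gfun A B θ)ᴴ * Mᴴ * Gfun A B θ * Φ θ).trace := by
      rw [← Matrix.mul_assoc, trace_mul_comm]
      simp only [Matrix.mul_assoc]
    simp [this, h θ hθ]

theorem isHermitian_of_inRangeGamma {B : Matrix (Fin n) (Fin m) ℂ}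
    {M : Matrix (Fin n) (Fin n) ℂ} (hM : InRangeGamma A B M) : M.IsHermitian := by
  obtain ⟨Φ, -, -, hΦ, rfl⟩ := hM
  exact isHermitian_circleIntM fun θ => isHermitian_mul_mul_conjTranspose _ (hΦ θ)

end TransferFunction

section ResolventCurve

variable {m : ℕ} {Q H : ℝ → Matrix (Fin m) (Fin m) ℂ}

/-- Invertibility of `Q θ` on a compact interval persists along small perturbations `x • H θ`,
uniformly in `θ`. -/
theorem exists_isOpen_isUnit_add_smul (hQ : Continuous Q) (hH : Continuous H) {a b : ℝ}
    (hu : ∀ θ ∈ Icc a b, IsUnit (Q θ)) :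
    ∃ V : Set ℝ, IsOpen V ∧ 0 ∈ V ∧ ∀ x ∈ V, ∀ θ ∈ Icc a b, IsUnit (Q θ + x • H θ) := by
  have hopen : IsOpen {p : ℝ × ℝ | (Q p.2 + p.1 • H p.2).det ≠ 0} :=
    isOpen_ne_fun (Continuous.matrix_det (by fun_prop)) continuous_const
  obtain ⟨V, W, hV, -, h0, hW, hVW⟩ := generalized_tube_lemma (isCompact_singleton (x := (0 : ℝ)))
    (isCompact_Icc (a := a) (b := b)) hopen (by
      rintro ⟨x, θ⟩ ⟨rfl, hθ⟩
      simpa [isUnit_iff_isUnit_det] using hu θ hθ)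
  refine ⟨V, hV, h0 rfl, fun x hx θ hθ => ?_⟩
  have : (x, θ) ∈ V ×ˢ W := ⟨hx, hW hθ⟩
  simpa [isUnit_iff_isUnit_det] using hVW this

theorem continuousOn_inv_add_smul (hQ : Continuous Q) (hH : Continuous H) {V S : Set ℝ}
    (hu : ∀ x ∈ V, ∀ θ ∈ S, IsUnit (Q θ + x • H θ)) :
    ContinuousOn (fun p : ℝ × ℝ => (Q p.2 + p.1 • H p.2)⁻¹) (V ×ˢ S) := by
  rintro ⟨x, θ⟩ ⟨hx, hθ⟩
  have hc : Continuous fun p : ℝ × ℝ => Q p.2 + p.1 • H p.2 := by fun_prop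
  exact (ContinuousAt.comp (f := fun p : ℝ × ℝ => Q p.2 + p.1 • H p.2)
    (continuousAt_inv_of_isUnit (hu x hx θ hθ)) hc.continuousAt).continuousWithinAt

end ResolventCurve

theorem stmt9 {n m : ℕ} (A : Matrix (Fin n) (Fin n) ℂ) (B : Matrix (Fin n) (Fin m) ℂ)
    (hA : ∀ z ∈ spectrum ℂ A, ‖z‖ < 1) (hB : B.rank = m) (hAB : IsReachable A B)
    (Ψ : ℝ → Matrix (Fin m) (Fin m) ℂ) (hΨc : Continuous Ψ)
    (hΨper : Function.Periodic Ψ (2 * Real.pi)) (hΨpd : ∀ θ : ℝ, (Ψ θ).PosDef)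
    (Λ : Matrix (Fin n) (Fin n) ℂ) (hΛmem : InRangeGamma A B Λ)
    (hQ : ∀ θ : ℝ, (Qfun A B Λ θ).PosDef)
    (δΛ : Matrix (Fin n) (Fin n) ℂ) (hδΛmem : InRangeGamma A B δΛ) (hδΛne : δΛ ≠ 0) :
    HasDerivAt (fun s : ℝ => deriv (fun t : ℝ => Jfun A B Ψ (Λ + s • δΛ + t • δΛ)) 0)
        ((hessQuad A B Ψ Λ δΛ).re) 0 ∧
      (hessQuad A B Ψ Λ δΛ).im = 0 ∧
      0 < (hessQuad A B Ψ Λ δΛ).re := by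
  have hπ : -Real.pi < Real.pi := by linarith [Real.pi_pos]
  have hG := continuous_Gfun hA B
  have hδH := isHermitian_of_inRangeGamma hδΛmem
  set H : ℝ → Matrix (Fin m) (Fin m) ℂ := fun θ => (Gfun A B θ)ᴴ * δΛ * Gfun A B θ with hHdef
  set Q : ℝ → Matrix (Fin m) (Fin m) ℂ := Qfun A B Λ with hQdef
  have hHc : Continuous H := (hG.matrix_conjTranspose.matrix_mul continuous_const).matrix_mul hG
  have hQc : Continuous Q := continuous_const.add
    ((hG.matrix_conjTranspose.matrix_mul continuous_const).matrix_mul hG)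
  have hHh : ∀ θ, (H θ)ᴴ = H θ := fun θ => isHermitian_conjTranspose_mul_mul _ hδH
  obtain ⟨V, hV, h0, hu⟩ := exists_isOpen_isUnit_add_smul hQc hHc
    (a := -Real.pi) (b := Real.pi) fun θ _ => (hQ θ).isUnit
  have hPc := continuousOn_inv_add_smul hQc hHc hu
  have hHc' : ContinuousOn (fun p : ℝ × ℝ => H p.2) (V ×ˢ Icc (-Real.pi) Real.pi) := by fun_prop
  have hΨc' : ContinuousOn (fun p : ℝ × ℝ => Ψ p.2) (V ×ˢ Icc (-Real.pi) Real.pi) := by fun_prop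
  have htr : Continuous (trace : Matrix (Fin m) (Fin m) ℂ → ℂ) := continuous_id.matrix_trace
  have hslice : ∀ x ∈ V, ContinuousOn (fun θ => (Q θ + x • H θ)⁻¹) (Icc (-Real.pi) Real.pi) :=
    fun x hx => hPc.comp (f := fun θ => (x, θ)) (by fun_prop) fun θ hθ => ⟨hx, hθ⟩
  set c : ℂ := (2 * (Real.pi : ℂ))⁻¹ with hc
  have hd0 := fun x (hx : x ∈ V) => hasDerivAt_intervalIntegral_of_continuousOn
    (F := fun x θ => ((Q θ + x • H θ)⁻¹ * Ψ θ).trace)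
    (F' := fun x θ => -((Q θ + x • H θ)⁻¹ * H θ * (Q θ + x • H θ)⁻¹ * Ψ θ).trace) hV hπ.le
    (htr.comp_continuousOn (hPc.mul hΨc'))
    (htr.comp_continuousOn (((hPc.mul hHc').mul hPc).mul hΨc')).neg
    (fun x hx θ hθ => hasDerivAt_trace_inv_mul (hu x hx θ hθ)) hx
  have hd1 := hasDerivAt_intervalIntegral_of_continuousOn
    (F := fun x θ => -((Q θ + x • H θ)⁻¹ * H θ * (Q θ + x • H θ)⁻¹ * Ψ θ).trace)
    (F' := fun x θ => 2 * ((Q θ + x • H θ)⁻¹ * H θ * (Q θ + x • H θ)⁻¹ * H θ *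
      (Q θ + x • H θ)⁻¹ * Ψ θ).trace) hV hπ.le
    (htr.comp_continuousOn (((hPc.mul hHc').mul hPc).mul hΨc')).neg
    ((continuousOn_const (c := (2 : ℂ))).mul
      (htr.comp_continuousOn (((((hPc.mul hHc').mul hPc).mul hHc').mul hPc).mul hΨc')))
    (fun x hx θ hθ => hasDerivAt_neg_trace_inv_mul_mul (hu x hx θ hθ)) h0
  have hJ : ∀ x ∈ V, Jfun A B Ψ (Λ + x • δΛ) =
      (c * (∫ θ in (-Real.pi)..Real.pi, ((Q θ + x • H θ)⁻¹ * Ψ θ).trace) +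
        (Λ.trace + x * δΛ.trace)).re := by
    intro x hx
    simp only [Jfun, Qfun_add_smul]
    rw [trace_circleIntM
      (F := fun θ => (Q θ + x • H θ)⁻¹ * Ψ θ) ((hslice x hx).mul hΨc.continuousOn)]
    simp [hQdef, hHdef, hc]
  have hderiv : ∀ s ∈ V, deriv (fun t : ℝ => Jfun A B Ψ (Λ + s • δΛ + t • δΛ)) 0 =
      (c * (∫ θ in (-Real.pi)..Real.pi,
        -((Q θ + s • H θ)⁻¹ * H θ * (Q θ + s • H θ)⁻¹ * Ψ θ).trace) + δΛ.trace).re := by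
    intro s hs
    have hlin : HasDerivAt (fun x : ℝ => Λ.trace + (x : ℂ) * δΛ.trace) δΛ.trace s := by
      simpa using ((Complex.ofRealCLM.hasDerivAt (x := s)).mul_const δΛ.trace).const_add Λ.trace
    have h := Complex.reCLM.hasFDerivAt.comp_hasDerivAt s (((hd0 s hs).const_mul c).add hlin)
    have h' : HasDerivAt (fun x : ℝ => Jfun A B Ψ (Λ + x • δΛ)) _ s :=
      h.congr_of_eventuallyEq (by
        filter_upwards [hV.mem_nhds hs] with x hx
        simpa using hJ x hx)
    have h'' := HasDerivAt.comp_const_add s 0 (by rw [add_zero]; exact h')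
    simp only [add_smul, ← add_assoc] at h''
    exact h''.deriv
  set r : ℝ → ℂ := fun θ => (Ψ θ * ((H θ * (Q θ)⁻¹)ᴴ * (Q θ)⁻¹ * (H θ * (Q θ)⁻¹))).trace with hr
  have hQi : ∀ θ, ((Q θ)⁻¹)ᴴ = (Q θ)⁻¹ := fun θ => (hQ θ).isHermitian.inv
  have hQic : Continuous fun θ => (Q θ)⁻¹ := continuous_iff_continuousAt.2 fun θ =>
    ContinuousAt.comp (continuousAt_inv_of_isUnit (hQ θ).isUnit) hQc.continuousAt
  have hrc : Continuous r := htr.comp (hΨc.mul ((((hHc.mul hQic).matrix_conjTranspose).mul hQic).mul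
    (hHc.mul hQic)))
  have hrpos := fun θ => trace_mul_conjTranspose_mul_mul (X := H θ * (Q θ)⁻¹)
    (hΨpd θ) (hQ θ).inv
  have hrre : ∀ θ, ((r θ).re : ℂ) = r θ := fun θ => (Complex.eq_re_of_ofReal_le (hrpos θ).1).symm
  have hhess : hessQuad A B Ψ Λ δΛ = 2 * (c * ∫ θ in (-Real.pi)..Real.pi, r θ) := by
    have hpt : (fun θ => Ψ θ * (Qfun A B Λ θ)⁻¹ * (Gfun A B θ)ᴴ * δΛ * Gfun A B θ *
          (Qfun A B Λ θ)⁻¹ * (Gfun A B θ)ᴴ * δΛ * Gfun A B θ * (Qfun A B Λ θ)⁻¹) =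
        fun θ => Ψ θ * ((H θ * (Q θ)⁻¹)ᴴ * (Q θ)⁻¹ * (H θ * (Q θ)⁻¹)) := by
      funext θ
      simp only [conjTranspose_mul (H θ), hQi, hHh]
      simp only [hHdef, hQdef, Matrix.mul_assoc]
    rw [hessQuad, hpt, trace_circleIntM]
    exact (hΨc.mul ((((hHc.mul hQic).matrix_conjTranspose).mul hQic).mul
      (hHc.mul hQic))).continuousOn
  have hhess' : hessQuad A B Ψ Λ δΛ =
      ((2 * ((2 * Real.pi)⁻¹ * ∫ θ in (-Real.pi)..Real.pi, (r θ).re) : ℝ) : ℂ) := by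
    rw [hhess, hc]
    push_cast
    rw [← intervalIntegral.integral_ofReal]
    simp only [hrre]
  refine ⟨?_, by rw [hhess', Complex.ofReal_im], ?_⟩
  · have h := Complex.reCLM.hasFDerivAt.comp_hasDerivAt (0 : ℝ)
      ((hd1.const_mul c).add_const δΛ.trace)
    refine (h.congr_of_eventuallyEq (f₁ := fun s : ℝ =>
      deriv (fun t : ℝ => Jfun A B Ψ (Λ + s • δΛ + t • δΛ)) 0) ?_).congr_deriv ?_
    · filter_upwards [hV.mem_nhds h0] with s hs
      simpa using hderiv s hs
    · rw [hhess, intervalIntegral.integral_const_mul]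
      have hpt : ∀ θ, ((Q θ + (0 : ℝ) • H θ)⁻¹ * H θ * (Q θ + (0 : ℝ) • H θ)⁻¹ * H θ *
          (Q θ + (0 : ℝ) • H θ)⁻¹ * Ψ θ).trace = r θ := by
        intro θ
        rw [trace_mul_comm]
        simp only [hr, zero_smul, add_zero, conjTranspose_mul, hQi, hHh, Matrix.mul_assoc]
      simp only [hpt, Complex.reCLM_apply]
      congr 1
      ring
  · rw [hhess', Complex.ofReal_re]
    have hint : 0 < ∫ θ in (-Real.pi)..Real.pi, (r θ).re := by
      refine intervalIntegral.integral_pos hπ (Complex.continuous_re.comp hrc).continuousOn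
        (fun θ _ => (Complex.le_def.1 (hrpos θ).1).1) ?_
      by_contra! hle
      refine hδΛne (eq_zero_of_inRangeGamma hG hδΛmem fun θ hθ => ?_)
      rw [hδH]
      have hz : r θ = 0 := by
        rw [← hrre θ, le_antisymm (hle θ hθ) (Complex.le_def.1 (hrpos θ).1).1, Complex.ofReal_zero]
      exact ((hQ θ).inv.isUnit.mul_left_eq_zero).1 ((hrpos θ).2 hz)
    positivity
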